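/- Let G be a finite simple graph, k a positive integer, and e = xy an edge of G. Then γ_{P,k}(G/e) ≤ γ_{P,k}(G) + 1, where G/e is the graph obtained from G by deleting x and y and adding a new vertex v_{xy} adjacent to every vertex of (N_G(x) ∪ N_G(y)) \ {x, y}. -/

import Mathlib

open SimpleGraph

variable {V : Type*}

/-- The closed neighbourhood `N_G[v]` of a vertex. -/
def closedNbhd (G : SimpleGraph V) (v : V) : Set V := insert v (G.neighborSet v)

/-- The closed neighbourhood `N_G[X]` of a set of vertices. -/
def closedNbhdSet (G : SimpleGraph V) (X : Set V) : Set V := ⋃ v ∈ X, closedNbhd G v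

/-- The sets `P^i_{G,k}(S)` of vertices monitored by `S` at step `i`. -/
def monitored (G : SimpleGraph V) (k : ℕ) (S : Set V) : ℕ → Set V
  | 0 => closedNbhdSet G S
  | i + 1 =>
      ⋃ v ∈ {w | w ∈ monitored G k S i ∧ (closedNbhd G w \ monitored G k S i).ncard ≤ k},
        closedNbhd G v

/-- `S` is a `k`-power dominating set of `G`. -/
def IsPDS (G : SimpleGraph V) (k : ℕ) (S : Set V) : Prop :=
  ∃ i, monitored G k S i = Set.univ

/-- The `k`-power domination number `γ_{P,k}(G)`. -/
noncomputable def pdn (G : SimpleGraph V) (k : ℕ) : ℕ :=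
  sInf {n | ∃ S : Set V, IsPDS G k S ∧ S.ncard = n}

/-- The radius `rad_{P,k}(G,S)` of a `k`-PDS `S`. -/
noncomputable def radPDS (G : SimpleGraph V) (k : ℕ) (S : Set V) : ℕ :=
  1 + sInf {i | monitored G k S i = Set.univ}

/-- The `k`-propagation radius `rad_{P,k}(G)`. -/
noncomputable def propRad (G : SimpleGraph V) (k : ℕ) : ℕ :=
  sInf {r | ∃ S : Set V, IsPDS G k S ∧ S.ncard = pdn G k ∧ radPDS G k S = r}

/-- The contraction `G/e` of the edge `e = xy`: delete `x` and `y` and replace them by a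
new vertex (represented by `x`) adjacent to all vertices in `(N_G(x) ∪ N_G(y)) \ {x, y}`. -/
def contractEdge (G : SimpleGraph V) (x y : V) : SimpleGraph {u : V // u ≠ y} :=
  SimpleGraph.fromRel (fun a b =>
    ((a : V) = x ∧ (G.Adj x b ∨ G.Adj y b)) ∨ ((a : V) ≠ x ∧ (b : V) ≠ x ∧ G.Adj a b))

lemma mem_closedNbhd_iff {G : SimpleGraph V} {u v : V} :
    u ∈ closedNbhd G v ↔ u = v ∨ G.Adj v u := by
  simp [closedNbhd]

/-- Once the whole closed neighbourhood of a vertex is monitored, it stays monitored. -/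
lemma closedNbhd_subset_monitored_succ {G : SimpleGraph V} {k i : ℕ} {S : Set V} {v : V}
    (h : closedNbhd G v ⊆ monitored G k S i) : closedNbhd G v ⊆ monitored G k S (i + 1) := by
  intro u hu
  simp only [monitored, Set.mem_iUnion, Set.mem_ofPred_eq]
  refine ⟨v, ⟨h (Set.mem_insert _ _), ?_⟩, hu⟩
  simp [Set.sdiff_eq_empty.2 h]

lemma closedNbhd_subset_monitored {G : SimpleGraph V} {k : ℕ} {S : Set V} {v : V}
    (hv : v ∈ S) (i : ℕ) : closedNbhd G v ⊆ monitored G k S i := by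
  induction i with
  | zero => exact Set.subset_biUnion_of_mem (u := closedNbhd G) hv
  | succ i ih => exact closedNbhd_subset_monitored_succ ih

lemma isPDS_univ (G : SimpleGraph V) (k : ℕ) : IsPDS G k Set.univ :=
  ⟨0, Set.eq_univ_of_forall fun v =>
    closedNbhd_subset_monitored (Set.mem_univ v) 0 (Set.mem_insert _ _)⟩

lemma exists_isPDS_ncard_eq_pdn (G : SimpleGraph V) (k : ℕ) :
    ∃ S : Set V, IsPDS G k S ∧ S.ncard = pdn G k :=
  Nat.sInf_mem (s := {n | ∃ S : Set V, IsPDS G k S ∧ S.ncard = n}) ⟨_, _, isPDS_univ G k, rfl⟩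

lemma mem_closedNbhd_of_contractEdge {G : SimpleGraph V} {x y : V} {u v : {u : V // u ≠ y}}
    (hu : (u : V) ≠ x) (hv : (v : V) ≠ x) (h : u ∈ closedNbhd (contractEdge G x y) v) :
    (u : V) ∈ closedNbhd G v := by
  rw [mem_closedNbhd_iff] at h ⊢
  rcases h with rfl | ⟨-, h⟩
  · exact Or.inl rfl
  · simp only [hu, hv, ne_eq, not_false_eq_true, false_and, true_and, false_or] at h
    exact Or.inr (h.elim id fun h => h.symm)

/-- The quotient map from the vertices of `G` to those of `G/e`. -/
def contractMap [DecidableEq V] {x y : V} (hne : x ≠ y) (u : V) : {u : V // u ≠ y} :=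
  if h : u = y then ⟨x, hne⟩ else ⟨u, h⟩

section contractMap

variable [DecidableEq V] {G : SimpleGraph V} {x y : V}

lemma contractMap_of_ne (hne : x ≠ y) (u : {u : V // u ≠ y}) : contractMap hne u = u := by
  simp [contractMap, u.2]

lemma contractMap_mem_closedNbhd (hne : x ≠ y) {u v : V} (h : u ∈ closedNbhd G v) :
    contractMap hne u ∈ closedNbhd (contractEdge G x y) (contractMap hne v) := by
  rw [mem_closedNbhd_iff] at h ⊢
  rcases h with rfl | h
  · exact Or.inl rfl
  · rw [or_iff_not_imp_left]
    intro hn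
    have h' := h.symm
    refine ⟨Ne.symm hn, ?_⟩
    unfold contractMap at hn ⊢
    by_cases hu : u = y <;> by_cases hv : v = y <;> by_cases hux : u = x <;>
      by_cases hvx : v = x <;> simp_all

/-- If `S'` contains the contracted vertex and the image of `S`, then at every step it monitors
the image of what `S` monitors. -/
lemma contractMap_mem_monitored [Finite V] (hne : x ≠ y) {k : ℕ} {S : Set V}
    {S' : Set {u : V // u ≠ y}} (hS : ∀ s ∈ S, contractMap hne s ∈ S') (hx : ⟨x, hne⟩ ∈ S')
    (i : ℕ) : ∀ u ∈ monitored G k S i,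
      contractMap hne u ∈ monitored (contractEdge G x y) k S' i := by
  induction i with
  | zero =>
    intro u hu
    simp only [monitored, closedNbhdSet, Set.mem_iUnion] at hu ⊢
    obtain ⟨s, hs, hu⟩ := hu
    exact ⟨_, hS s hs, contractMap_mem_closedNbhd hne hu⟩
  | succ i ih =>
    intro u hu
    simp only [monitored, Set.mem_iUnion] at hu
    obtain ⟨v, ⟨hv, hcard⟩, hu⟩ := hu
    have hu' := contractMap_mem_closedNbhd hne hu
    by_cases hvx : contractMap hne v = ⟨x, hne⟩
    · rw [hvx] at hu'
      exact closedNbhd_subset_monitored hx _ hu'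
    · simp only [monitored, Set.mem_iUnion]
      refine ⟨_, ⟨ih v hv, le_trans ?_ hcard⟩, hu'⟩
      refine Set.ncard_le_ncard_of_injOn Subtype.val ?_ Subtype.val_injective.injOn
      rintro w ⟨hw, hwm⟩
      have hwx : (w : V) ≠ x := by
        rintro rfl
        exact hwm (closedNbhd_subset_monitored hx i (Set.mem_insert _ _))
      have hvy : v ≠ y := by
        rintro rfl
        simp [contractMap] at hvx
      rw [contractMap_of_ne hne ⟨v, hvy⟩] at hvx hw
      refine ⟨mem_closedNbhd_of_contractEdge hwx (fun h => hvx (Subtype.ext h)) hw, fun hwi => ?_⟩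
      have := ih _ hwi
      rw [contractMap_of_ne] at this
      exact hwm this

end contractMap

theorem pdn_edge_contraction_upper {V : Type*} [Fintype V] [DecidableEq V]
    (G : SimpleGraph V) (k : ℕ) (hk : 0 < k) (x y : V) (hxy : G.Adj x y) :
    pdn (contractEdge G x y) k ≤ pdn G k + 1 := by
  have hne : x ≠ y := hxy.ne
  obtain ⟨S, ⟨i, hi⟩, hcard⟩ := exists_isPDS_ncard_eq_pdn G k
  have hS : IsPDS (contractEdge G x y) k (insert ⟨x, hne⟩ (contractMap hne '' S)) := by
    refine ⟨i, Set.eq_univ_of_forall fun u => ?_⟩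
    rw [← contractMap_of_ne hne u]
    exact contractMap_mem_monitored hne
      (fun s hs => Set.mem_insert_of_mem _ (Set.mem_image_of_mem _ hs)) (Set.mem_insert _ _) i u
      (hi ▸ Set.mem_univ _)
  calc pdn (contractEdge G x y) k
      ≤ (insert ⟨x, hne⟩ (contractMap hne '' S)).ncard := Nat.sInf_le ⟨_, hS, rfl⟩
    _ ≤ (contractMap hne '' S).ncard + 1 := Set.ncard_insert_le _ _
    _ ≤ pdn G k + 1 := by
      rw [← hcard]
      exact Nat.add_le_add_right (Set.ncard_image_le S.toFinite) 1
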